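/- arXiv:1408.5647 — 2 statements merged into one kernel-verified Lean document; each statement's English description precedes it below -/
import Mathlib

section
/- Let K ⊂ ℝ³ be a convex body. Suppose that every p ∈ bd K has an open neighborhood U ⊂ ℝ³ and a nonzero real polynomial q of degree at most 2 in three variables such that bd K ∩ U is contained in the zero set of q. Then bd K is an ellipsoid. -/
open scoped RealInnerProductSpace
open MeasureTheory

noncomputable section

/-- Euclidean 3-space. -/
abbrev E3 : Type := EuclideanSpace ℝ (Fin 3)

/-- The line through `p` with direction vector `v`. -/
def lineThrough (p v : E3) : Set E3 := {x : E3 | ∃ t : ℝ, x = p + t • v}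

/-- A line in `ℝ³`. -/
def IsLine (L : Set E3) : Prop := ∃ p v : E3, v ≠ 0 ∧ L = lineThrough p v

/-- A plane in `ℝ³` with prescribed unit normal `n`. -/
def IsPlaneWithNormal (H : Set E3) (n : E3) : Prop :=
  ‖n‖ = 1 ∧ ∃ c : ℝ, H = {x : E3 | ⟪n, x⟫ = c}

/-- A plane in `ℝ³`. -/
def IsPlane (H : Set E3) : Prop := ∃ n : E3, IsPlaneWithNormal H n

/-- The unit circle `{(cos t, sin t, 0)}` in the plane `z = 0`. -/
def unitCircle3 : Set E3 := {x : E3 | x 0 ^ 2 + x 1 ^ 2 = 1 ∧ x 2 = 0}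

/-- An ellipse in `ℝ³`: the image of the unit circle under an invertible affine map. -/
def IsEllipse (E : Set E3) : Prop := ∃ f : E3 ≃ᵃ[ℝ] E3, E = f '' unitCircle3

/-- An ellipsoid in `ℝ³`: the image of the unit sphere under an invertible affine map. -/
def IsEllipsoid (S : Set E3) : Prop := ∃ f : E3 ≃ᵃ[ℝ] E3, S = f '' Metric.sphere (0 : E3) 1

/-- A circle in `ℝ³`: the points of some plane at fixed positive distance from a
center lying in that plane. -/
def IsCircle (C : Set E3) : Prop :=
  ∃ (H : Set E3) (c : E3) (r : ℝ), IsPlane H ∧ c ∈ H ∧ 0 < r ∧ C = {x ∈ H | dist x c = r}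

/-- A sphere in `ℝ³`. -/
def IsSphere (S : Set E3) : Prop := ∃ (c : E3) (r : ℝ), 0 < r ∧ S = Metric.sphere c r

/-- A convex body: compact, convex, with nonempty interior. -/
def IsConvexBody (K : Set E3) : Prop := IsCompact K ∧ Convex ℝ K ∧ (interior K).Nonempty

/-- A line `L` is tangent to `bd K` if it meets `K` but not the interior of `K`. -/
def IsTangentLine (K L : Set E3) : Prop := (L ∩ K).Nonempty ∧ L ∩ interior K = ∅

/-- An outward function on the boundary of a convex body `K`. -/
def IsOutwardFunction (K : Set E3) (Ψ : E3 → E3) : Prop :=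
  ContinuousOn Ψ (frontier K) ∧
  ∀ p ∈ frontier K, ‖Ψ p‖ = 1 ∧
    ¬ IsTangentLine K (lineThrough p (Ψ p)) ∧
    (∀ t : ℝ, 0 < t → p + t • Ψ p ∉ K) ∧
    ∃ q ∈ frontier K, q ∉ lineThrough p (Ψ p) ∧
      (lineThrough p (Ψ p) ∩ lineThrough q (Ψ q) ∩ interior K).Nonempty

/-- `L` is a line parallel to the direction `u`. -/
def LineParallel (L : Set E3) (u : E3) : Prop := ∃ p : E3, L = lineThrough p u

/-- A system of lines: for every direction `u ∈ S²` exactly one member line parallel to `u`. -/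
def IsLineSystem (𝓛 : Set (Set E3)) : Prop :=
  (∀ L ∈ 𝓛, IsLine L) ∧ ∀ u : E3, ‖u‖ = 1 → ∃! L, L ∈ 𝓛 ∧ LineParallel L u

/-- A continuous system of lines: the map `δ` sending each direction `u ∈ S²` to the point
of `L_u` closest to the origin is continuous. -/
def IsContinuousLineSystem (𝓛 : Set (Set E3)) : Prop :=
  IsLineSystem 𝓛 ∧ ∃ δ : E3 → E3, ContinuousOn δ (Metric.sphere (0 : E3) 1) ∧
    ∀ u : E3, ‖u‖ = 1 → ∀ L ∈ 𝓛, LineParallel L u →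
      δ u ∈ L ∧ ∀ x ∈ L, ‖δ u‖ ≤ ‖x‖

/-- The center of a system of lines: points lying on at least two distinct lines. -/
def lineSystemCenter (𝓛 : Set (Set E3)) : Set E3 :=
  {x : E3 | ∃ L₁ ∈ 𝓛, ∃ L₂ ∈ 𝓛, L₁ ≠ L₂ ∧ x ∈ L₁ ∧ x ∈ L₂}

/-- A smooth convex body: each boundary point has a unique (unit outer normal of a)
support plane. -/
def IsSmoothBody (K : Set E3) : Prop :=
  ∀ p ∈ frontier K, ∃! n : E3, ‖n‖ = 1 ∧ ∀ x ∈ K, ⟪n, x⟫ ≤ ⟪n, p⟫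

/-- A strictly convex body: the boundary contains no line segment. -/
def IsStrictlyConvexBody (K : Set E3) : Prop :=
  ∀ x ∈ frontier K, ∀ y ∈ frontier K, x ≠ y → ¬ segment ℝ x y ⊆ frontier K

/-- `η` is an outer unit normal field of `K` on its boundary. -/
def IsOuterNormal (K : Set E3) (η : E3 → E3) : Prop :=
  ∀ p ∈ frontier K, ‖η p‖ = 1 ∧ ∀ x ∈ K, ⟪η p, x⟫ ≤ ⟪η p, p⟫

/-- The boundary of `K` is a `C^k` surface: locally, after a rigid motion, it is the graph
of a `C^k` function of two variables. -/
def HasContDiffBoundary (K : Set E3) (k : ℕ) : Prop :=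
  ∀ p ∈ frontier K, ∃ (e : E3 ≃ᵃⁱ[ℝ] E3) (g : ℝ × ℝ → ℝ) (U : Set E3),
    IsOpen U ∧ p ∈ U ∧ ContDiff ℝ k g ∧
    frontier K ∩ U = {x ∈ U | e x 2 = g (e x 0, e x 1)}

end

open Filter Topology Set in
theorem eq_zero_of_eventually_eq_zero {E : Type*} [NormedAddCommGroup E] [NormedSpace ℝ E]
    {F : E → ℝ} (hF : AnalyticOnNhd ℝ F univ) {p : E} (hp : ∀ᶠ v in 𝓝 p, F v = 0) (v : E) :
    F v = 0 :=
  hF.eqOn_zero_of_preconnected_of_eventuallyEq_zero isPreconnected_univ (mem_univ p) hp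
    (mem_univ v)

theorem analyticOnNhd_diagonal {E : Type*} [NormedAddCommGroup E] [NormedSpace ℝ E]
    (B : E →L[ℝ] E →L[ℝ] ℝ) (s : Set E) : AnalyticOnNhd ℝ (fun v => B v v) s := fun v _ =>
  (B.analyticAt_bilinear (v, v)).comp₂ analyticAt_id analyticAt_id

/-- A quadratic form vanishing on the kernel of a nonzero linear functional is divisible by it. -/
theorem exists_linear_cofactor {E : Type*} [NormedAddCommGroup E] [NormedSpace ℝ E]
    (D : E →L[ℝ] E →L[ℝ] ℝ) (β : E →L[ℝ] ℝ) (hβ : β ≠ 0) (h : ∀ v, β v = 0 → D v v = 0) :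
    ∃ l : E →L[ℝ] ℝ, ∀ v, D v v = β v * l v := by
  obtain ⟨e₀, he₀⟩ : ∃ e, β e ≠ 0 := by
    by_contra! hc
    exact hβ (ContinuousLinearMap.ext hc)
  obtain ⟨e, he⟩ : ∃ e, β e = 1 := ⟨(β e₀)⁻¹ • e₀, by simp [he₀]⟩
  refine ⟨D.flip e + D e - (D e e) • β, fun v => ?_⟩
  have hw := h (v - β v • e) (by simp [he])
  simp only [map_sub, map_smul, sub_apply, smul_apply, smul_eq_mul] at hw
  simp only [add_apply, sub_apply,
    smul_apply, ContinuousLinearMap.flip_apply, smul_eq_mul]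
  linarith

/-- Near `p`, the function `g` is a root of the monic quadratic polynomial with linear
coefficient `b` and constant coefficient the quadratic form of `B`. -/
def IsQuadraticRootNear {E : Type*} [NormedAddCommGroup E] [NormedSpace ℝ E] (g : E → ℝ)
    (b : E →L[ℝ] ℝ) (B : E →L[ℝ] E →L[ℝ] ℝ) (p : E) : Prop :=
  ∀ᶠ v in nhds p, g v ^ 2 + b v * g v + B v v = 0

open Filter Topology Set in
theorem IsQuadraticRootNear.unique {E : Type*} [NormedAddCommGroup E] [NormedSpace ℝ E]
    {g : E → ℝ} (hflat : ∀ (l : E →L[ℝ] ℝ) (p : E), p ≠ 0 → ¬ ∀ᶠ v in 𝓝 p, g v = l v)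
    {b b' : E →L[ℝ] ℝ} {B B' : E →L[ℝ] E →L[ℝ] ℝ} {p : E}
    (h : IsQuadraticRootNear g b B p) (h' : IsQuadraticRootNear g b' B' p) :
    b = b' ∧ ∀ v, B v v = B' v v := by
  have hlin : ∀ᶠ v in 𝓝 p, (b - b') v * g v + (B - B') v v = 0 := by
    filter_upwards [h, h'] with v hv hv'
    simp only [sub_apply]
    linarith
  by_cases hβ : b - b' = 0
  · refine ⟨sub_eq_zero.1 hβ, fun v => sub_eq_zero.1 ?_⟩
    have := eq_zero_of_eventually_eq_zero (analyticOnNhd_diagonal (B - B') univ)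
      (hlin.mono fun v hv => by simpa [hβ] using hv) v
    simpa using this
  exfalso
  have hres : ∀ v, (B - B') v v ^ 2 - b v * (B - B') v v * (b - b') v
      + B v v * (b - b') v ^ 2 = 0 := by
    refine eq_zero_of_eventually_eq_zero (p := p) ?_ ?_
    · have h1 := analyticOnNhd_diagonal (B - B') univ
      have h2 := analyticOnNhd_diagonal B univ
      have h3 := b.analyticOnNhd univ
      have h4 := (b - b').analyticOnNhd univ
      exact ((h1.pow 2).sub ((h3.mul h1).mul h4)).add (h2.mul (h4.pow 2))
    · filter_upwards [h, hlin] with v hv hl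
      rw [eq_neg_of_add_eq_zero_right hl]
      linear_combination (b - b') v ^ 2 * hv
  obtain ⟨l, hl⟩ := exists_linear_cofactor (B - B') (b - b') hβ fun v hv => by
    have := hres v
    rw [hv] at this
    simpa using this
  obtain ⟨x, hx, hx0⟩ : ∃ x, (∀ᶠ v in 𝓝 x, (b - b') v * g v + (B - B') v v = 0) ∧
      (b - b') x ≠ 0 := by
    by_contra! hc
    exact hβ (ContinuousLinearMap.ext fun v => eq_zero_of_eventually_eq_zero
      ((b - b').analyticOnNhd univ) ((eventually_eventually_nhds.2 hlin).mono hc) v)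
  refine hflat (-l) x (fun h0 => hx0 (by simp [h0])) ?_
  filter_upwards [hx, (b - b').continuous.continuousAt.eventually_ne hx0] with v hv hv0
  rw [hl, ← mul_add] at hv
  have := (mul_eq_zero.1 hv).resolve_left hv0
  rw [neg_apply]
  linarith

open Filter Topology Set in
theorem not_eventually_eq_linear {E : Type*} [NormedAddCommGroup E] [NormedSpace ℝ E]
    [FiniteDimensional ℝ E] (hdim : 2 < Module.finrank ℝ E) {g : E → ℝ} (hg : Continuous g)
    (hadd : ∀ u v, g (u + v) ≤ g u + g v) (hsmul : ∀ t : ℝ, 0 ≤ t → ∀ v, g (t • v) = t * g v)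
    (hpos : ∀ v, v ≠ 0 → 0 < g v) (hcomp : IsCompact {v | g v = 1})
    (hroot : ∀ p, p ≠ 0 → ∃ b B, IsQuadraticRootNear g b B p)
    (l : E →L[ℝ] ℝ) (p₀ : E) (hp₀ : p₀ ≠ 0) : ¬ ∀ᶠ v in 𝓝 p₀, g v = l v := by
  intro hl
  have hge : ∀ v, l v ≤ g v := by
    have hconv : ConvexOn ℝ univ fun v => g v - l v := by
      refine ⟨convex_univ, fun x _ y _ a c ha hc _ => ?_⟩
      have := hadd (a • x) (c • y)
      rw [hsmul a ha, hsmul c hc] at this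
      simp only [map_add, map_smul, smul_eq_mul]
      linarith
    have hmin : IsLocalMin (fun v => g v - l v) p₀ := by
      filter_upwards [hl] with v hv
      simp [hv, hl.self_of_nhds]
    intro v
    have := IsMinOn.of_isLocalMin_of_convex_univ hmin hconv v
    simp only [hl.self_of_nhds, sub_self] at this
    linarith
  have hT : IsCompact ({v | g v = 1} ∩ {v | l v = 1}) :=
    hcomp.inter_right (isClosed_eq l.continuous continuous_const)
  have hTne : ({v | g v = 1} ∩ {v | l v = 1}).Nonempty := by
    have h0 := hpos p₀ hp₀
    refine ⟨(g p₀)⁻¹ • p₀, ?_, ?_⟩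
    · simp only [mem_ofPred_eq, hsmul _ (inv_nonneg.2 h0.le)]
      exact inv_mul_cancel₀ h0.ne'
    · simp only [mem_ofPred_eq, map_smul, smul_eq_mul, ← hl.self_of_nhds]
      exact inv_mul_cancel₀ h0.ne'
  obtain ⟨p, hp⟩ := hT.extremePoints_nonempty hTne
  rw [mem_extremePoints] at hp
  obtain ⟨⟨hgp, hlp⟩, hext⟩ := hp
  simp only [mem_ofPred_eq] at hgp hlp
  have hp0 : p ≠ 0 := by
    rintro rfl
    simp at hlp
  obtain ⟨b, B, hQ⟩ := hroot p hp0
  have hQl : ∀ v, l v ^ 2 + b v * l v + B v v = 0 := by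
    obtain ⟨t, ht, hQt⟩ : ∃ t : ℝ, 0 < t ∧ ∀ᶠ v in 𝓝 (p + t • p₀),
        g v ^ 2 + b v * g v + B v v = 0 := by
      have hc : Tendsto (fun t : ℝ => p + t • p₀) (𝓝[>] 0) (𝓝 p) := by
        have : Continuous fun t : ℝ => p + t • p₀ := by fun_prop
        simpa using (this.tendsto 0).mono_left nhdsWithin_le_nhds
      have := (hc.eventually (eventually_eventually_nhds.2 hQ)).and self_mem_nhdsWithin
      obtain ⟨t, h1, h2⟩ := this.exists
      exact ⟨t, h2, h1⟩
    refine eq_zero_of_eventually_eq_zero (p := p + t • p₀) ?_ ?_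
    · have h1 := l.analyticOnNhd univ
      have h2 := b.analyticOnNhd univ
      exact ((h1.pow 2).add (h2.mul h1)).add (analyticOnNhd_diagonal B univ)
    · have hc : Tendsto (fun v => t⁻¹ • (v - p)) (𝓝 (p + t • p₀)) (𝓝 p₀) := by
        have : Continuous fun v => t⁻¹ • (v - p) := by fun_prop
        simpa [smul_smul, inv_mul_cancel₀ ht.ne'] using this.tendsto (p + t • p₀)
      filter_upwards [hQt, hc.eventually hl] with v hv hlv
      have hgl : g v = l v := by
        refine le_antisymm ?_ (hge v)
        have := hadd p (v - p)
        rw [hsmul _ (inv_nonneg.2 ht.le), map_smul, smul_eq_mul] at hlv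
        rw [mul_left_cancel₀ (inv_ne_zero ht.ne') hlv, map_sub] at this
        simp only [add_sub_cancel] at this
        linarith
      rwa [hgl] at hv
  obtain ⟨w, hw0, hlw, hbw⟩ : ∃ w : E, w ≠ 0 ∧ l w = 0 ∧ b w = 0 := by
    have hker : LinearMap.ker ((l.prod b : E →L[ℝ] ℝ × ℝ) : E →ₗ[ℝ] ℝ × ℝ) ≠ ⊥ :=
      LinearMap.ker_ne_bot_of_finrank_lt (by simpa using hdim)
    obtain ⟨w, hw, hw0⟩ := Submodule.exists_mem_ne_zero_of_ne_bot hker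
    have : l w = 0 ∧ b w = 0 := by simpa using hw
    exact ⟨w, hw0, this⟩
  have hcw : Continuous fun t : ℝ => p + t • w := by fun_prop
  have hev : ∀ᶠ t : ℝ in 𝓝 0, g (p + t • w) = 1 := by
    have h1 : ∀ᶠ t : ℝ in 𝓝 0, (g (p + t • w) - 1) * (g (p + t • w) + (1 + b p)) = 0 := by
      have := (hcw.tendsto' 0 p (by simp)).eventually hQ
      filter_upwards [this] with t ht
      have h2 := hQl (p + t • w)
      simp only [map_add l, map_add b, map_smul l, map_smul b, hlw, hbw, hlp, smul_zero,
        add_zero] at h2 ht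
      linear_combination ht - h2
    by_cases hd : (1 : ℝ) + (1 + b p) = 0
    · filter_upwards [h1] with t ht
      have h3 : 1 + b p = -1 := by linarith
      rw [h3] at ht
      have : (g (p + t • w) - 1) * (g (p + t • w) - 1) = 0 := ht
      linarith [mul_self_eq_zero.1 this]
    · have h2 : ∀ᶠ t : ℝ in 𝓝 0, g (p + t • w) + (1 + b p) ≠ 0 := by
        have hc : Continuous fun t : ℝ => g (p + t • w) + (1 + b p) := by fun_prop
        exact hc.continuousAt.eventually_ne (by simpa [hgp] using hd)
      filter_upwards [h1, h2] with t ht ht'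
      linarith [(mul_eq_zero.1 ht).resolve_right ht']
  obtain ⟨ε, hε, hball⟩ := Metric.eventually_nhds_iff.1 hev
  have hmem : ∀ t : ℝ, |t| < ε → p + t • w ∈ {v | g v = 1} ∩ {v | l v = 1} := fun t ht =>
    ⟨hball (by simpa using ht), by simp [hlw, hlp]⟩
  have h2 : |ε / 2| < ε := by rw [abs_of_pos (by linarith)]; linarith
  have := (hext _ (hmem (ε / 2) h2) _ (hmem (-(ε / 2)) (by rwa [abs_neg]))
    ⟨1 / 2, 1 / 2, by norm_num, by norm_num, by norm_num, by module⟩).1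
  simp [hw0, hε.ne'] at this

open Filter Topology Set in
theorem exists_global_quadratic_root {E : Type*} [NormedAddCommGroup E] [NormedSpace ℝ E]
    [FiniteDimensional ℝ E] (hdim : 2 < Module.finrank ℝ E) {g : E → ℝ}
    (hflat : ∀ (l : E →L[ℝ] ℝ) (p : E), p ≠ 0 → ¬ ∀ᶠ v in 𝓝 p, g v = l v)
    (hroot : ∀ p, p ≠ 0 → ∃ b B, IsQuadraticRootNear g b B p) :
    ∃ (b : E →L[ℝ] ℝ) (B : E →L[ℝ] E →L[ℝ] ℝ),
      ∀ v, v ≠ 0 → g v ^ 2 + b v * g v + B v v = 0 := by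
  have hrank : 1 < Module.rank ℝ E := by
    rw [← Module.finrank_eq_rank]
    exact_mod_cast (by lia : 1 < Module.finrank ℝ E)
  have : Nontrivial E := Module.nontrivial_of_finrank_pos (R := ℝ) (by lia)
  obtain ⟨e, he⟩ := exists_ne (0 : E)
  obtain ⟨b, B, h⟩ := hroot e he
  refine ⟨b, B, fun v hv => ?_⟩
  set S : Set E := {p | IsQuadraticRootNear g b B p} with hS
  have hSo : IsOpen S := isOpen_setOfPred_eventually_nhds
  have hS'o : IsOpen ({0}ᶜ \ S) := by
    rw [isOpen_iff_mem_nhds]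
    rintro p ⟨hp0, hpS⟩
    obtain ⟨b', B', h'⟩ := hroot p hp0
    filter_upwards [isOpen_compl_singleton.mem_nhds hp0, eventually_eventually_nhds.2 h']
      with x hx0 hx
    refine ⟨hx0, fun hxS => hpS ?_⟩
    obtain ⟨hb, hB⟩ := IsQuadraticRootNear.unique hflat hxS hx
    filter_upwards [h'] with y hy
    rwa [hb, hB]
  have hsub : ({0}ᶜ : Set E) ⊆ S :=
    (isConnected_compl_singleton_of_one_lt_rank hrank 0).isPreconnected.subset_left_of_subset_union
      hSo hS'o disjoint_sdiff_right (by simp) ⟨e, he, h⟩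
  exact (hsub hv : IsQuadraticRootNear g b B v).self_of_nhds

theorem QuadraticMap.PosDef.exists_linearEquiv_norm_sq {E : Type*} [AddCommGroup E] [Module ℝ E]
    [FiniteDimensional ℝ E] {n : ℕ} (hn : Module.finrank ℝ E = n) {Q : QuadraticForm ℝ E}
    (hQ : Q.PosDef) : ∃ T : E ≃ₗ[ℝ] EuclideanSpace ℝ (Fin n), ∀ v, Q v = ‖T v‖ ^ 2 := by
  have hS := Q.equivalent_one_zero_neg_one_weighted_sum_squared
  rw [hn] at hS
  obtain ⟨w, hw, ⟨e⟩⟩ := hS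
  have hw1 : ∀ i, w i = 1 := by
    intro i
    have hpos : 0 < QuadraticMap.weightedSumSquares ℝ w (Pi.single i 1) := by
      rw [← e.apply_symm_apply (Pi.single i 1), e.map_app]
      refine hQ _ fun h0 => ?_
      have := congrArg e h0
      simp at this
    rw [QuadraticMap.weightedSumSquares_apply] at hpos
    simp [Pi.single_apply] at hpos
    rcases hw i with h | h | h <;> rw [h] at hpos <;> first | exact h | norm_num at hpos
  refine ⟨e.toLinearEquiv.trans (WithLp.linearEquiv 2 ℝ (Fin n → ℝ)).symm, fun v => ?_⟩
  rw [← e.map_app, QuadraticMap.weightedSumSquares_apply, EuclideanSpace.norm_sq_eq]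
  simp [hw1, ← pow_two]

theorem isEllipsoid_of_posDef {Q : QuadraticForm ℝ E3} (hQ : Q.PosDef) (b : E3 →ₗ[ℝ] ℝ) (c : E3) :
    IsEllipsoid {x | Q (x - c) - b (x - c) = 1} := by
  obtain ⟨T, hT⟩ := hQ.exists_linearEquiv_norm_sq (finrank_euclideanSpace_fin (n := 3))
  set a : E3 := (InnerProductSpace.toDual ℝ E3).symm
    (LinearMap.toContinuousLinearMap (b ∘ₗ T.symm.toLinearMap)) with ha
  have hb : ∀ v, b v = ⟪a, T v⟫ := fun v => by simp [ha]
  have hpos : 0 < 1 + ‖a‖ ^ 2 / 4 := by positivity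
  set R : ℝ := √(1 + ‖a‖ ^ 2 / 4) with hR
  have hR0 : 0 < R := Real.sqrt_pos.2 hpos
  have hR2 : R ^ 2 = 1 + ‖a‖ ^ 2 / 4 := Real.sq_sqrt hpos.le
  let f : E3 ≃ᵃ[ℝ] E3 :=
    ((LinearEquiv.smulOfNeZero ℝ E3 R hR0.ne').toAffineEquiv.trans
      (AffineEquiv.constVAdd ℝ E3 ((1 / 2 : ℝ) • a))).trans
      (T.symm.toAffineEquiv.trans (AffineEquiv.constVAdd ℝ E3 c))
  have hf : ∀ y, T (f y - c) = (1 / 2 : ℝ) • a + R • y := fun y => by simp [f]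
  have key : ∀ y, Q (f y - c) - b (f y - c) = 1 ↔ ‖y‖ = 1 := by
    intro y
    have h1 : ‖T (f y - c) - (1 / 2 : ℝ) • a‖ ^ 2 = R ^ 2 * ‖y‖ ^ 2 := by
      rw [hf, add_sub_cancel_left, norm_smul, mul_pow, Real.norm_eq_abs, sq_abs]
    rw [norm_sub_sq_real, norm_smul, inner_smul_right, real_inner_comm] at h1
    rw [hT, hb]
    have h2 : ‖(1 / 2 : ℝ)‖ = 1 / 2 := by norm_num
    rw [h2] at h1
    have h3 : ‖T (f y - c)‖ ^ 2 - ⟪a, T (f y - c)⟫ = 1 ↔ R ^ 2 * ‖y‖ ^ 2 = R ^ 2 := by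
      constructor <;> intro h <;> linarith
    rw [h3, mul_eq_left₀ (by positivity), pow_eq_one_iff_of_nonneg (norm_nonneg y) two_ne_zero]
  refine ⟨f, Set.ext fun x => ?_⟩
  obtain ⟨y, rfl⟩ := f.surjective x
  rw [f.injective.mem_set_image, mem_sphere_zero_iff_norm]
  exact key y

theorem isEllipsoid_of_quadratic_root {g : E3 → ℝ} (h0 : g 0 = 0) (hpos : ∀ v, v ≠ 0 → 0 < g v)
    (b : E3 →L[ℝ] ℝ) (B : E3 →L[ℝ] E3 →L[ℝ] ℝ)
    (h : ∀ v, v ≠ 0 → g v ^ 2 + b v * g v + B v v = 0) (c : E3) :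
    IsEllipsoid {x | g (x - c) = 1} := by
  have hprod : ∀ v, v ≠ 0 → B v v = -(g v * g (-v)) ∧ b v = g (-v) - g v := by
    intro v hv
    have hv' : -v ≠ 0 := neg_ne_zero.2 hv
    have h1 := h v hv
    have h2 := h (-v) hv'
    simp only [map_neg, neg_apply, neg_neg] at h2
    have hs : g v + g (-v) ≠ 0 := (add_pos (hpos v hv) (hpos _ hv')).ne'
    constructor <;> refine mul_right_cancel₀ hs ?_
    · linear_combination g (-v) * h1 + g v * h2
    · linear_combination h1 - h2
  let Q : QuadraticForm ℝ E3 := LinearMap.BilinMap.toQuadraticMap (-B).toLinearMap₁₂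
  have hQ : ∀ v, Q v = -B v v := fun v => by simp [Q]
  have hQpos : Q.PosDef := fun v hv => by
    rw [hQ, (hprod v hv).1, neg_neg]
    exact mul_pos (hpos v hv) (hpos _ (neg_ne_zero.2 hv))
  convert isEllipsoid_of_posDef hQpos b c using 3 with x
  rw [hQ]
  generalize x - c = v
  by_cases hv : v = 0
  · simp [hv, h0]
  have hp := hpos _ (neg_ne_zero.2 hv)
  simp only [ContinuousLinearMap.coe_coe]
  rw [(hprod v hv).1, (hprod v hv).2]
  constructor
  · intro h1
    rw [h1]
    ring
  · intro h1
    have : (g v - 1) * (g (-v) + 1) = 0 := by linear_combination h1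
    linarith [(mul_eq_zero.1 this).resolve_right (by linarith)]

/-- A polynomial of degree at most two is the sum of a constant, a linear form and a
quadratic form. -/
theorem exists_quadratic_expansion (q : MvPolynomial (Fin 3) ℝ) (hq : q.totalDegree ≤ 2) :
    ∃ (a : ℝ) (b : E3 →L[ℝ] ℝ) (B : E3 →L[ℝ] E3 →L[ℝ] ℝ),
      ∀ x : E3, MvPolynomial.eval (fun i => x i) q = a + b x + B x x := by
  suffices H : ∀ s ∈ q.support, ∃ (a : ℝ) (b : E3 →L[ℝ] ℝ) (B : E3 →L[ℝ] E3 →L[ℝ] ℝ),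
      ∀ x : E3, ∏ i, x i ^ s i = a + b x + B x x by
    choose! a b B h using H
    refine ⟨∑ s ∈ q.support, q.coeff s * a s, ∑ s ∈ q.support, q.coeff s • b s,
      ∑ s ∈ q.support, q.coeff s • B s, fun x => ?_⟩
    rw [MvPolynomial.eval_eq', Finset.sum_congr rfl fun s hs => by rw [h s hs x]]
    simp only [mul_add, Finset.sum_add_distrib, sum_apply, smul_apply,
      smul_eq_mul]
  intro s hs
  have hdeg : s 0 + s 1 + s 2 ≤ 2 := by
    have := (MvPolynomial.le_totalDegree hs).trans hq
    rwa [Finsupp.sum_fintype _ _ fun _ => rfl, Fin.sum_univ_three] at this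
  let e : Fin 3 → E3 →L[ℝ] ℝ := fun i => EuclideanSpace.proj i
  have hlin : ∀ i, ∃ (a : ℝ) (b : E3 →L[ℝ] ℝ) (B : E3 →L[ℝ] E3 →L[ℝ] ℝ),
      ∀ x : E3, x i = a + b x + B x x := fun i => ⟨0, e i, 0, fun x => by simp [e]⟩
  have hquad : ∀ i j, ∃ (a : ℝ) (b : E3 →L[ℝ] ℝ) (B : E3 →L[ℝ] E3 →L[ℝ] ℝ),
      ∀ x : E3, x i * x j = a + b x + B x x := fun i j =>
    ⟨0, 0, (e i).smulRight (e j), fun x => by simp [e]⟩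
  simp only [Fin.prod_univ_three]
  have h0 : s 0 ≤ 2 := by lia
  have h1 : s 1 ≤ 2 := by lia
  have h2 : s 2 ≤ 2 := by lia
  generalize s 0 = k₀ at *
  generalize s 1 = k₁ at *
  generalize s 2 = k₂ at *
  interval_cases k₀ <;> interval_cases k₁ <;> interval_cases k₂ <;>
    first
      | lia
      | simp only [pow_zero, pow_one, one_mul, mul_one, sq]
        first
          | exact hlin _
          | exact hquad _ _
          | exact ⟨1, 0, 0, by simp⟩

theorem exists_mem_eval_ne_zero {U : Set E3} (hU : IsOpen U) (hne : U.Nonempty)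
    {q : MvPolynomial (Fin 3) ℝ} (hq : q ≠ 0) :
    ∃ x ∈ U, MvPolynomial.eval (fun i => x i) q ≠ 0 := by
  by_contra! hc
  obtain ⟨p, hp⟩ := hne
  refine hq (MvPolynomial.funext fun x => ?_)
  have han : AnalyticOnNhd ℝ (fun x : E3 => MvPolynomial.eval (fun i => x i) q) Set.univ :=
    AnalyticOnNhd.eval_continuousLinearMap'
      (fun i => (EuclideanSpace.proj i : E3 →L[ℝ] ℝ)) q
  simpa using eq_zero_of_eventually_eq_zero han
    (Filter.eventually_of_mem (hU.mem_nhds hp) hc) (WithLp.toLp 2 x)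

open Filter Topology in
/-- Homogenization of a quadratic equation satisfied near a point of the hypersurface `g = 1`
centred at `c`. -/
theorem exists_isQuadraticRootNear {g : E3 → ℝ} (hg : Continuous g) {c : E3}
    {q : MvPolynomial (Fin 3) ℝ} (hq : q.totalDegree ≤ 2)
    (hc : MvPolynomial.eval (fun i => c i) q ≠ 0) {p : E3} (hp : g p ≠ 0)
    (h : ∀ᶠ v in 𝓝 p, MvPolynomial.eval (fun i => (c + (g v)⁻¹ • v) i) q = 0) :
    ∃ b B, IsQuadraticRootNear g b B p := by
  obtain ⟨a, b, B, hf⟩ := exists_quadratic_expansion q hq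
  set d := MvPolynomial.eval (fun i => c i) q with hd
  have hdc := hf c
  refine ⟨d⁻¹ • (b + B c + B.flip c), d⁻¹ • B, ?_⟩
  filter_upwards [h, hg.continuousAt.eventually_ne hp] with v hv hv0
  rw [hf] at hv
  simp only [map_add, map_smul, add_apply, smul_apply, smul_eq_mul,
    ContinuousLinearMap.flip_apply] at hv ⊢
  have h1 : d + (g v)⁻¹ * (b v + B c v + B v c) + (g v)⁻¹ ^ 2 * B v v = 0 := by
    linear_combination hv + hdc
  field_simp at h1 ⊢
  linear_combination h1

open Filter Topology Set in
/-- If the boundary of a convex body is locally contained in quadrics,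
then it is an ellipsoid. -/
theorem locally_quadric_boundary_ellipsoid (K : Set E3) (hK : IsConvexBody K)
    (h : ∀ p ∈ frontier K, ∃ (U : Set E3) (q : MvPolynomial (Fin 3) ℝ),
      IsOpen U ∧ p ∈ U ∧ q ≠ 0 ∧ q.totalDegree ≤ 2 ∧
      ∀ x ∈ frontier K ∩ U, MvPolynomial.eval (fun i => x i) q = 0) :
    IsEllipsoid (frontier K) := by
  obtain ⟨hcomp, hconv, hint⟩ := hK
  choose! U q hUo hpU hq0 hqdeg hqU using h
  have hfc : IsCompact (frontier K) := hcomp.of_isClosed_subset isClosed_frontier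
    hcomp.isClosed.frontier_subset
  obtain ⟨t, ht, hcover⟩ := hfc.elim_nhds_subcover U fun p hp => (hUo p hp).mem_nhds (hpU p hp)
  obtain ⟨c, hcK, hc⟩ := exists_mem_eval_ne_zero isOpen_interior hint
    (Finset.prod_ne_zero_iff.2 fun p hp => hq0 p (ht p hp))
  rw [map_prod, Finset.prod_ne_zero_iff] at hc
  set L : Set E3 := (c + ·) ⁻¹' K with hL
  have hLnhds : L ∈ 𝓝 0 := by
    have : Tendsto (c + ·) (𝓝 (0 : E3)) (𝓝 c) :=
      (continuous_const_add c).tendsto' 0 c (by simp)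
    exact this (mem_interior_iff_mem_nhds.1 hcK)
  have hLconv : Convex ℝ L := hconv.translate_preimage_right c
  have hLcomp : IsCompact L := (Homeomorph.addLeft c).isCompact_preimage.2 hcomp
  have hLfr : frontier L = (c + ·) ⁻¹' frontier K :=
    ((Homeomorph.addLeft c).preimage_frontier K).symm
  have habs : Absorbent ℝ L := absorbent_nhds_zero hLnhds
  have hone : ∀ v, gauge L v = 1 ↔ c + v ∈ frontier K := fun v => by
    rw [gauge_eq_one_iff_mem_frontier hLconv hLnhds, hLfr, mem_preimage]
  have hg := continuous_gauge hLconv hLnhds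
  have hpos : ∀ v, v ≠ 0 → 0 < gauge L v := fun v hv =>
    (gauge_pos habs ((NormedSpace.isVonNBounded_iff ℝ).2 hLcomp.isBounded)).2 hv
  have hsmul : ∀ t : ℝ, 0 ≤ t → ∀ v, gauge L (t • v) = t * gauge L v := fun t ht v =>
    gauge_smul_of_nonneg ht v
  have hroot : ∀ p, p ≠ 0 → ∃ b B, IsQuadraticRootNear (gauge L) b B p := by
    intro p hp
    have hmem : ∀ v, v ≠ 0 → c + (gauge L v)⁻¹ • v ∈ frontier K := fun v hv => by
      rw [← hone, hsmul _ (inv_nonneg.2 (hpos v hv).le), inv_mul_cancel₀ (hpos v hv).ne']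
    obtain ⟨y, hyt, hy⟩ := mem_iUnion₂.1 (hcover (hmem p hp))
    refine exists_isQuadraticRootNear hg (hqdeg y (ht y hyt)) (hc y hyt) (hpos p hp).ne' ?_
    have hcont : ContinuousAt (fun v => c + (gauge L v)⁻¹ • v) p :=
      continuousAt_const.add ((hg.continuousAt.inv₀ (hpos p hp).ne').smul continuousAt_id)
    filter_upwards [hcont.eventually_mem ((hUo y (ht y hyt)).mem_nhds hy),
      isOpen_compl_singleton.mem_nhds hp] with v hv hv0
    exact hqU y (ht y hyt) _ ⟨hmem v hv0, hv⟩
  have hlevel : IsCompact {v | gauge L v = 1} := by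
    convert (Homeomorph.addLeft c).isCompact_preimage.2 hfc using 1
    exact ext hone
  have hdim : 2 < Module.finrank ℝ E3 := by simp
  obtain ⟨b, B, hbB⟩ := exists_global_quadratic_root hdim
    (not_eventually_eq_linear hdim hg (gauge_add_le hLconv habs) hsmul hpos hlevel hroot) hroot
  convert isEllipsoid_of_quadratic_root gauge_zero hpos b B hbB c using 1
  ext x
  simp [hone]
end

section
/- Let E ⊂ ℝ³ be an ellipsoid and let H be a plane such that E ∩ H is a circle. Then for every plane H' parallel to H that meets E in more than one point, E ∩ H' is a circle. -/
open scoped RealInnerProductSpace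
open MeasureTheory

/-- A circle in the plane with normal `m` contains, in every direction of that plane, a pair of
points symmetric about its center. -/
lemma symmetric_points_mem_circle {m o v : E3} {d r : ℝ} (ho : ⟪m, o⟫ = d) (hr : 0 < r)
    (hv : v ≠ 0) (hmv : ⟪m, v⟫ = 0) :
    o + (r / ‖v‖) • v ∈ {x ∈ {x : E3 | ⟪m, x⟫ = d} | dist x o = r} ∧
      o - (r / ‖v‖) • v ∈ {x ∈ {x : E3 | ⟪m, x⟫ = d} | dist x o = r} := by
  have hv' : ‖v‖ ≠ 0 := norm_ne_zero_iff.2 hv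
  have hnorm : ‖(r / ‖v‖) • v‖ = r := by
    rw [norm_smul, Real.norm_of_nonneg (by positivity)]
    field_simp
  refine ⟨⟨?_, ?_⟩, ⟨?_, ?_⟩⟩
  · simp [inner_add_right, inner_smul_right, ho, hmv]
  · rw [dist_eq_norm, add_sub_cancel_left, hnorm]
  · simp [inner_sub_right, inner_smul_right, ho, hmv]
  · rw [dist_eq_norm, sub_sub_cancel_left, norm_neg, hnorm]

/-- A vector whose orthogonal complement contains the orthogonal complement of `m` is a
multiple of `m`. -/
lemma exists_eq_smul_of_orthogonal_le {m n : E3}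
    (h : ∀ v : E3, ⟪m, v⟫ = 0 → ⟪n, v⟫ = 0) : ∃ t : ℝ, n = t • m := by
  have hn : n ∈ (Submodule.span ℝ {m})ᗮᗮ := by
    rw [Submodule.mem_orthogonal]
    intro v hv
    rw [real_inner_comm]
    exact h v (Submodule.mem_orthogonal_singleton_iff_inner_right.1 hv)
  rw [Submodule.orthogonal_orthogonal, Submodule.mem_span_singleton] at hn
  obtain ⟨t, ht⟩ := hn
  exact ⟨t, ht.symm⟩

/-- A plane containing a circle is the plane of that circle: its directions are directions of
the plane of the circle. -/
lemma inner_eq_zero_of_circle_subset {m n o : E3} {c d r : ℝ} (hn : n ≠ 0) (ho : ⟪m, o⟫ = d)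
    (hr : 0 < r)
    (hsub : {x ∈ {x : E3 | ⟪m, x⟫ = d} | dist x o = r} ⊆ {x : E3 | ⟪n, x⟫ = c})
    {v : E3} (hv : ⟪n, v⟫ = 0) : ⟪m, v⟫ = 0 := by
  obtain ⟨t, rfl⟩ : ∃ t : ℝ, n = t • m := by
    refine exists_eq_smul_of_orthogonal_le fun v hmv => ?_
    rcases eq_or_ne v 0 with rfl | hv0
    · simp
    obtain ⟨h₁, h₂⟩ := symmetric_points_mem_circle ho hr hv0 hmv
    have e₁ : ⟪n, o + (r / ‖v‖) • v⟫ = c := hsub h₁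
    have e₂ : ⟪n, o - (r / ‖v‖) • v⟫ = c := hsub h₂
    rw [inner_add_right, inner_smul_right] at e₁
    rw [inner_sub_right, inner_smul_right] at e₂
    have hs : r / ‖v‖ ≠ 0 := div_ne_zero hr.ne' (norm_ne_zero_iff.2 hv0)
    have hz : r / ‖v‖ * ⟪n, v⟫ = 0 := by linarith
    exact (mul_eq_zero.1 hz).resolve_left hs
  have ht : t ≠ 0 := fun h => hn (by simp [h])
  rw [real_inner_smul_left] at hv
  exact (mul_eq_zero.1 hv).resolve_left ht

/-- If the ellipsoid `{x | ‖g x‖ = 1}` has a circular section with normal `n`, then the linear part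
of `g` is a similarity on the orthogonal complement of `n`. -/
lemma exists_norm_sq_linear_eq_of_isCircle (g : E3 →ᵃ[ℝ] E3) {n : E3} {c : ℝ} (hn : n ≠ 0)
    (hcirc : IsCircle ({x : E3 | ‖g x‖ = 1} ∩ {x : E3 | ⟪n, x⟫ = c})) :
    ∃ k : ℝ, ∀ v : E3, ⟪n, v⟫ = 0 → ‖g.linear v‖ ^ 2 = k * ‖v‖ ^ 2 := by
  obtain ⟨_, o, r, ⟨m, -, d, rfl⟩, ho, hr, hC⟩ := hcirc
  refine ⟨(1 - ‖g o‖ ^ 2) / r ^ 2, fun v hv => ?_⟩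
  rcases eq_or_ne v 0 with rfl | hv0
  · simp
  have hmv := inner_eq_zero_of_circle_subset hn ho hr (hC ▸ Set.inter_subset_right) hv
  have hmem := symmetric_points_mem_circle ho hr hv0 hmv
  rw [← hC] at hmem
  have e₁ : ‖g (o + (r / ‖v‖) • v)‖ = 1 := hmem.1.1
  have e₂ : ‖g (o - (r / ‖v‖) • v)‖ = 1 := hmem.2.1
  rw [add_comm, ← vadd_eq_add, g.map_vadd, vadd_eq_add, add_comm, map_smul] at e₁
  rw [sub_eq_add_neg, add_comm, ← vadd_eq_add, g.map_vadd, vadd_eq_add, add_comm, map_neg,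
    ← sub_eq_add_neg, map_smul] at e₂
  have hpar := parallelogram_law_with_norm ℝ (g o) ((r / ‖v‖) • g.linear v)
  have hv' : 0 < ‖v‖ := norm_pos_iff.2 hv0
  rw [e₁, e₂, norm_smul, Real.norm_of_nonneg (by positivity)] at hpar
  field_simp at hpar ⊢
  linarith

/-- If the linear part of `g` is a similarity on the orthogonal complement of `n`, then every
section of `{x | ‖g x‖ = 1}` with normal `n` and more than one point is a circle. -/
lemma isCircle_of_norm_sq_linear_eq (g : E3 →ᵃ[ℝ] E3) (hg : Function.Injective g.linear)
    {n : E3} {c k : ℝ} (hn : ‖n‖ = 1)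
    (hk : ∀ v : E3, ⟪n, v⟫ = 0 → ‖g.linear v‖ ^ 2 = k * ‖v‖ ^ 2)
    (hmeet : ({x : E3 | ‖g x‖ = 1} ∩ {x : E3 | ⟪n, x⟫ = c}).Nontrivial) :
    IsCircle ({x : E3 | ‖g x‖ = 1} ∩ {x : E3 | ⟪n, x⟫ = c}) := by
  obtain ⟨a, ⟨haE, haH⟩, b, ⟨hbE, hbH⟩, hab⟩ := hmeet
  simp only [Set.mem_ofPred_eq] at haE haH hbE hbH
  have hdir : ∀ {x : E3}, ⟪n, x⟫ = c → ⟪n, x - a⟫ = 0 := fun h => by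
    rw [inner_sub_right, h, haH, sub_self]
  have hba : b - a ≠ 0 := sub_ne_zero.2 hab.symm
  have hkpos : 0 < k := by
    have h₁ : 0 < ‖g.linear (b - a)‖ ^ 2 := by
      have : g.linear (b - a) ≠ 0 := (map_ne_zero_iff _ hg).2 hba
      positivity
    rw [hk _ (hdir hbH)] at h₁
    exact pos_of_mul_pos_left h₁ (by positivity)
  set y : E3 := LinearMap.adjoint g.linear (g a)
  set w : E3 := y - ⟪n, y⟫ • n
  have hnw : ⟪n, w⟫ = 0 := by
    simp [w, inner_sub_right, inner_smul_right, hn]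
  have hiff : ∀ x : E3, ⟪n, x⟫ = c → (‖g x‖ = 1 ↔ dist x (a - k⁻¹ • w) = k⁻¹ * ‖w‖) := by
    intro x hx
    have hv := hdir hx
    have hw : ⟪g a, g.linear (x - a)⟫ = ⟪w, x - a⟫ := by
      rw [← LinearMap.adjoint_inner_left, inner_sub_left, real_inner_smul_left, hv, mul_zero,
        sub_zero]
    have hgx : g x = g a + g.linear (x - a) := by
      rw [add_comm, ← vadd_eq_add, ← g.map_vadd, vadd_eq_add, sub_add_cancel]
    have h₁ : ‖g x‖ ^ 2 = 1 + 2 * ⟪w, x - a⟫ + k * ‖x - a‖ ^ 2 := by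
      rw [hgx, norm_add_sq_real, haE, hw, hk _ hv, one_pow]
    have h₂ : dist x (a - k⁻¹ • w) ^ 2 =
        ‖x - a‖ ^ 2 + 2 * (k⁻¹ * ⟪w, x - a⟫) + (k⁻¹ * ‖w‖) ^ 2 := by
      rw [dist_eq_norm, ← sub_add, norm_add_sq_real, real_inner_smul_right, real_inner_comm,
        norm_smul, Real.norm_of_nonneg (by positivity)]
    rw [← sq_eq_sq₀ (norm_nonneg _) zero_le_one, ← sq_eq_sq₀ dist_nonneg (by positivity), h₁, h₂]
    field_simp
    rw [add_eq_right, mul_eq_zero, or_iff_right hkpos.ne']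
    constructor <;> intro h <;> linarith
  have hw0 : w ≠ 0 := by
    intro hw
    have h := (hiff b hbH).1 hbE
    rw [hw, smul_zero, sub_zero, norm_zero, mul_zero] at h
    exact hab (dist_eq_zero.1 h).symm
  refine ⟨{x : E3 | ⟪n, x⟫ = c}, a - k⁻¹ • w, k⁻¹ * ‖w‖, ⟨n, hn, c, rfl⟩, ?_, by positivity, ?_⟩
  · simp [inner_sub_right, inner_smul_right, haH, hnw]
  · ext x
    exact ⟨fun h => ⟨h.2, (hiff x h.2).1 h.1⟩, fun h => ⟨(hiff x h.1).2 h.2, h.1⟩⟩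

/-- If a plane cuts an ellipsoid in a circle, then every parallel plane
meeting the ellipsoid in more than one point also cuts it in a circle. -/
theorem parallel_sections_of_circular_section (E : Set E3) (hE : IsEllipsoid E)
    (n : E3) (hn : ‖n‖ = 1) (c c' : ℝ)
    (hcirc : IsCircle (E ∩ {x : E3 | ⟪n, x⟫ = c}))
    (hmeet : ∃ a b : E3, a ≠ b ∧ a ∈ E ∩ {x : E3 | ⟪n, x⟫ = c'} ∧
      b ∈ E ∩ {x : E3 | ⟪n, x⟫ = c'}) :
    IsCircle (E ∩ {x : E3 | ⟪n, x⟫ = c'}) := by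
  obtain ⟨f, rfl⟩ := hE
  have hE : f '' Metric.sphere (0 : E3) 1 = {x : E3 | ‖(f.symm : E3 →ᵃ[ℝ] E3) x‖ = 1} := by
    ext x
    constructor
    · rintro ⟨y, hy, rfl⟩
      simpa using hy
    · intro hx
      exact ⟨f.symm x, by simpa using hx, f.apply_symm_apply x⟩
  rw [hE] at hcirc hmeet ⊢
  have hn0 : n ≠ 0 := norm_ne_zero_iff.1 (by simp [hn])
  obtain ⟨k, hk⟩ := exists_norm_sq_linear_eq_of_isCircle _ hn0 hcirc
  obtain ⟨a, b, hab, ha, hb⟩ := hmeet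
  exact isCircle_of_norm_sq_linear_eq _ f.symm.linear.injective hn hk ⟨a, ha, b, hb, hab⟩
end
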